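/- Let α and β be real numbers and n a positive integer. For integers 1 ≤ j < k ≤ n define d(j,k) = √(‖(k−j)α‖² + ‖(k−j)β‖²). For a real number γ let I^γ_{j,k} ⊆ [0,1) be the geodesic joining {jγ} and {kγ}: writing m = min({jγ},{kγ}) and M = max({jγ},{kγ}), set I^γ_{j,k} = [m, M) if M − m ≤ 1/2 and I^γ_{j,k} = [0, m) ∪ [M, 1) otherwise; write I¹_{j,k} = I^α_{j,k} and I²_{j,k} = I^β_{j,k}. Define S(n) = { d(j,k) : 1 ≤ j < k ≤ n, and for all 1 ≤ p < q ≤ n, d(p,q) < d(j,k) implies I¹_{p,q} ∩ I¹_{j,k} = ∅ and I²_{p,q} ∩ I²_{j,k} = ∅ }. Then |S(n)| ≤ 11. -/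

import Mathlib

/-- `nint x` is the distance from the real number `x` to the nearest integer. -/
noncomputable def nint (x : ℝ) : ℝ := |x - round x|

/-- The "geodesic" on the circle `[0,1)` joining two points `a, b ∈ [0,1)`. -/
noncomputable def geodesic (a b : ℝ) : Set ℝ :=
  if max a b - min a b ≤ 1 / 2 then Set.Ico (min a b) (max a b)
  else Set.Ico 0 (min a b) ∪ Set.Ico (max a b) 1

/-- `len2 α β q = √(‖qα‖² + ‖qβ‖²)`, the length of the integer `q` w.r.t. `(α, β)`. -/
noncomputable def len2 (α β : ℝ) (q : ℕ) : ℝ :=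
  Real.sqrt (nint ((q : ℝ) * α) ^ 2 + nint ((q : ℝ) * β) ^ 2)

/-- The signed displacement from `a` to `b` along `geodesic a b`. -/
noncomputable def disp (a b : ℝ) : ℝ :=
  if |b - a| ≤ 1 / 2 then b - a else if a < b then b - a - 1 else b - a + 1

/-- The signed residue of `p * γ` modulo one, of absolute value at most `1 / 2`. -/
noncomputable def res (γ : ℝ) (p : ℕ) : ℝ := (p : ℝ) * γ - round ((p : ℝ) * γ)

/-- The signed displacement from `{jγ}` to `{kγ}`. -/
noncomputable def dispMul (γ : ℝ) (j k : ℕ) : ℝ :=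
  disp (Int.fract ((j : ℝ) * γ)) (Int.fract ((k : ℝ) * γ))

lemma geodesic_comm (a b : ℝ) : geodesic a b = geodesic b a := by
  simp only [geodesic, max_comm a b, min_comm a b]

lemma disp_antisymm (a b : ℝ) : disp b a = -disp a b := by
  unfold disp
  rw [abs_sub_comm a b]
  split_ifs with h1 h2 h3 h3
  · ring
  · linarith
  · ring
  · ring
  · have : a = b := le_antisymm (not_lt.1 h2) (not_lt.1 h3)
    subst this
    norm_num at h1

lemma dispMul_antisymm (γ : ℝ) (j k : ℕ) : dispMul γ k j = -dispMul γ j k :=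
  disp_antisymm _ _

lemma geodesic_inter_nonempty {a b c : ℝ} (ha : 0 ≤ a) (ha' : a < 1) (hb : 0 ≤ b) (hb' : b < 1)
    (hc : 0 ≤ c) (hc' : c < 1) (h : 0 < disp a b * disp a c) :
    (geodesic a b ∩ geodesic a c).Nonempty := by
  have pos : ∀ d : ℝ, 0 ≤ d → d < 1 → 0 < disp a d → a ∈ geodesic a d := by
    intro d hd hd' hp
    unfold disp at hp
    unfold geodesic
    rw [max_sub_min_eq_abs]
    split_ifs at hp ⊢ with h1 h2
    · rw [min_eq_left (by linarith), max_eq_right (by linarith)]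
      exact ⟨le_rfl, by linarith⟩
    · linarith
    · rw [max_eq_left (by linarith)]
      exact Or.inr ⟨le_rfl, ha'⟩
  have neg : ∀ d : ℝ, 0 ≤ d → d < 1 → disp a d < 0 →
      (d < a ∧ geodesic a d = Set.Ico d a) ∨
        (a < d ∧ geodesic a d = Set.Ico 0 a ∪ Set.Ico d 1) := by
    intro d hd hd' hp
    unfold disp at hp
    unfold geodesic
    rw [max_sub_min_eq_abs]
    split_ifs at hp ⊢ with h1 h2
    · left
      rw [min_eq_right (by linarith), max_eq_left (by linarith)]
      exact ⟨by linarith, rfl⟩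
    · right
      rw [min_eq_left (by linarith), max_eq_right (by linarith)]
      exact ⟨by linarith, rfl⟩
    · rw [abs_of_nonpos (by linarith)] at h1
      linarith
  rcases mul_pos_iff.1 h with ⟨h1, h2⟩ | ⟨h1, h2⟩
  · exact ⟨a, pos b hb hb' h1, pos c hc hc' h2⟩
  · rcases neg b hb hb' h1 with ⟨l1, e1⟩ | ⟨l1, e1⟩ <;>
      rcases neg c hc hc' h2 with ⟨l2, e2⟩ | ⟨l2, e2⟩ <;> rw [e1, e2]
    · exact ⟨max b c, ⟨le_max_left _ _, max_lt l1 l2⟩, ⟨le_max_right _ _, max_lt l1 l2⟩⟩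
    · exact ⟨b, ⟨le_rfl, l1⟩, Or.inl ⟨hb, l1⟩⟩
    · exact ⟨c, Or.inl ⟨hc, l2⟩, ⟨le_rfl, l2⟩⟩
    · exact ⟨max b c, Or.inr ⟨le_max_left _ _, max_lt hb' hc'⟩,
        Or.inr ⟨le_max_right _ _, max_lt hb' hc'⟩⟩

lemma abs_disp_le {a b : ℝ} (ha : 0 ≤ a) (ha' : a < 1) (hb : 0 ≤ b) (hb' : b < 1) :
    |disp a b| ≤ 1 / 2 := by
  unfold disp
  split_ifs with h1 h2
  · exact h1
  · rw [abs_of_pos (by linarith)] at h1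
    rw [abs_le]
    constructor <;> linarith
  · rw [abs_of_nonpos (by linarith)] at h1
    rw [abs_le]
    constructor <;> linarith

lemma disp_mul_disp_pos_of_half {a b c : ℝ} (ha : 0 ≤ a) (ha' : a < 1) (hb : 0 ≤ b) (hb' : b < 1)
    (hc : 0 ≤ c) (hc' : c < 1) (h1 : |disp a b| = 1 / 2) (h2 : |disp a c| = 1 / 2) :
    0 < disp a b * disp a c := by
  have key : ∀ d : ℝ, 0 ≤ d → d < 1 → |disp a d| = 1 / 2 →
      (disp a d = 1 / 2 ∧ a < 1 / 2) ∨ (disp a d = -(1 / 2) ∧ 1 / 2 ≤ a) := by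
    intro d hd hd' h
    rcases (abs_eq (by norm_num)).1 h with h | h
    · left
      refine ⟨h, ?_⟩
      unfold disp at h
      split_ifs at h with h3 h4
      · linarith
      · linarith
      · rw [abs_of_nonpos (by linarith)] at h3
        linarith
    · right
      refine ⟨h, ?_⟩
      unfold disp at h
      split_ifs at h with h3 h4
      · linarith
      · rw [abs_of_pos (by linarith)] at h3
        linarith
      · linarith
  rcases key b hb hb' h1 with ⟨e1, l1⟩ | ⟨e1, l1⟩ <;>
    rcases key c hc hc' h2 with ⟨e2, l2⟩ | ⟨e2, l2⟩ <;> first | linarith | (rw [e1, e2]; norm_num)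

lemma abs_dispMul_le (γ : ℝ) (j k : ℕ) : |dispMul γ j k| ≤ 1 / 2 :=
  abs_disp_le (Int.fract_nonneg _) (Int.fract_lt_one _) (Int.fract_nonneg _) (Int.fract_lt_one _)

lemma abs_res_le (γ : ℝ) (p : ℕ) : |res γ p| ≤ 1 / 2 := abs_sub_round _

lemma exists_dispMul_eq (γ : ℝ) {j p : ℕ} :
    ∃ m : ℤ, dispMul γ j (j + p) = (p : ℝ) * γ - m := by
  have e : Int.fract (((j + p : ℕ) : ℝ) * γ) - Int.fract ((j : ℝ) * γ) =
      (p : ℝ) * γ - ((⌊((j + p : ℕ) : ℝ) * γ⌋ - ⌊(j : ℝ) * γ⌋ : ℤ) : ℝ) := by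
    simp only [Int.fract]
    push_cast
    ring
  unfold dispMul disp
  rw [e]
  generalize (⌊((j + p : ℕ) : ℝ) * γ⌋ - ⌊(j : ℝ) * γ⌋ : ℤ) = m
  split_ifs
  · exact ⟨m, rfl⟩
  · exact ⟨m + 1, by push_cast; ring⟩
  · exact ⟨m - 1, by push_cast; ring⟩

lemma eq_of_abs_sub_int_le {x : ℝ} {m l : ℤ} (h1 : |x - m| < 1 / 2) (h2 : |x - l| ≤ 1 / 2) :
    m = l := by
  have h3 : |((m - l : ℤ) : ℝ)| < 1 := by
    push_cast
    rw [abs_lt] at *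
    rw [abs_le] at h2
    constructor <;> linarith
  have h4 : |m - l| < 1 := by exact_mod_cast h3
  have := Int.abs_lt_one_iff.1 h4
  omega

lemma res_eq_sub_int {γ : ℝ} {p : ℕ} {m : ℤ} (h : |(p : ℝ) * γ - m| < 1 / 2) :
    res γ p = (p : ℝ) * γ - m := by
  unfold res
  rw [eq_of_abs_sub_int_le h (abs_sub_round _)]

lemma dispMul_add_eq_res {γ : ℝ} {p : ℕ} (j : ℕ) (h : |res γ p| < 1 / 2) :
    dispMul γ j (j + p) = res γ p := by
  obtain ⟨m, hm⟩ := exists_dispMul_eq γ (j := j) (p := p)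
  have h2 := abs_dispMul_le γ j (j + p)
  rw [hm] at h2 ⊢
  unfold res at *
  rw [eq_of_abs_sub_int_le h h2]

lemma abs_dispMul_add (γ : ℝ) (j p : ℕ) : |dispMul γ j (j + p)| = |res γ p| := by
  rcases lt_or_eq_of_le (abs_res_le γ p) with h | h
  · rw [dispMul_add_eq_res j h]
  · obtain ⟨m, hm⟩ := exists_dispMul_eq γ (j := j) (p := p)
    refine le_antisymm (h ▸ abs_dispMul_le γ j _) ?_
    rw [hm]
    exact round_le _ _

lemma res_sub {γ : ℝ} {p q : ℕ} (hqp : q ≤ p) (h : |res γ p - res γ q| < 1 / 2) :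
    res γ (p - q) = res γ p - res γ q := by
  have e : res γ p - res γ q =
      ((p - q : ℕ) : ℝ) * γ - ((round ((p : ℝ) * γ) - round ((q : ℝ) * γ) : ℤ) : ℝ) := by
    unfold res
    push_cast [hqp]
    ring
  rw [e] at h ⊢
  exact res_eq_sub_int h

lemma abs_res_sub_le (γ : ℝ) {p q : ℕ} (hqp : q ≤ p) :
    |res γ (p - q)| ≤ |res γ p - res γ q| := by
  have e : res γ p - res γ q =
      ((p - q : ℕ) : ℝ) * γ - ((round ((p : ℝ) * γ) - round ((q : ℝ) * γ) : ℤ) : ℝ) := by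
    unfold res
    push_cast [hqp]
    ring
  rw [e]
  exact round_le _ _

lemma res_eq_zero_iff {γ : ℝ} {p : ℕ} : res γ p = 0 ↔ ∃ m : ℤ, (p : ℝ) * γ = m := by
  constructor
  · intro h
    exact ⟨_, sub_eq_zero.1 h⟩
  · rintro ⟨m, hm⟩
    have h0 : |(p : ℝ) * γ - m| < 1 / 2 := by rw [hm]; norm_num
    rw [res_eq_sub_int h0, hm, sub_self]

lemma res_sub_eq_zero {γ : ℝ} {p q : ℕ} (hqp : q ≤ p) (hp : res γ p = 0) (hq : res γ q = 0) :
    res γ (p - q) = 0 := by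
  rw [res_sub hqp (by rw [hp, hq]; norm_num), hp, hq, sub_self]

lemma abs_res_eq_half_iff {γ : ℝ} {p : ℕ} :
    |res γ p| = 1 / 2 ↔ ∃ m : ℤ, (p : ℝ) * γ = m + 1 / 2 := by
  constructor
  · intro h
    rcases (abs_eq (by norm_num)).1 h with h | h <;> unfold res at h
    · exact ⟨round ((p : ℝ) * γ), by linarith⟩
    · exact ⟨round ((p : ℝ) * γ) - 1, by push_cast; linarith⟩
  · rintro ⟨m, hm⟩
    by_contra h
    have h1 := eq_of_abs_sub_int_le (lt_of_le_of_ne (abs_res_le γ p) h)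
      (l := m) (by rw [hm]; norm_num)
    have h2 := eq_of_abs_sub_int_le (lt_of_le_of_ne (abs_res_le γ p) h)
      (l := m + 1) (by rw [hm]; push_cast; ring_nf; norm_num [abs_of_neg])
    omega

lemma res_sub_eq_zero_of_half {γ : ℝ} {p q : ℕ} (hqp : q ≤ p) (hp : |res γ p| = 1 / 2)
    (hq : |res γ q| = 1 / 2) : res γ (p - q) = 0 := by
  obtain ⟨m, hm⟩ := abs_res_eq_half_iff.1 hp
  obtain ⟨l, hl⟩ := abs_res_eq_half_iff.1 hq
  refine res_eq_zero_iff.2 ⟨m - l, ?_⟩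
  push_cast [hqp]
  linarith

lemma abs_res_sub_eq_half {γ : ℝ} {p q : ℕ} (hqp : q ≤ p) (hp : |res γ p| = 1 / 2)
    (hq : res γ q = 0) : |res γ (p - q)| = 1 / 2 := by
  obtain ⟨m, hm⟩ := abs_res_eq_half_iff.1 hp
  obtain ⟨l, hl⟩ := res_eq_zero_iff.1 hq
  refine abs_res_eq_half_iff.2 ⟨m - l, ?_⟩
  push_cast [hqp]
  linarith

lemma res_two_mul_eq_zero {γ : ℝ} {p : ℕ} (hp : |res γ p| = 1 / 2) : res γ (2 * p) = 0 := by
  obtain ⟨m, hm⟩ := abs_res_eq_half_iff.1 hp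
  refine res_eq_zero_iff.2 ⟨2 * m + 1, ?_⟩
  push_cast
  linarith

lemma fract_eq_of_modEq {γ : ℝ} {z i j : ℕ} (hz : res γ z = 0) (h : i ≡ j [MOD z]) :
    Int.fract ((i : ℝ) * γ) = Int.fract ((j : ℝ) * γ) := by
  obtain ⟨m, hm⟩ := res_eq_zero_iff.1 hz
  obtain ⟨c, hc⟩ := (Nat.modEq_iff_dvd.1 h.symm)
  have hc' : (i : ℝ) - j = z * c := by exact_mod_cast hc
  rw [Int.fract_eq_fract]
  refine ⟨m * c, ?_⟩
  push_cast
  rw [← sub_mul, hc', ← hm]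
  ring

/-- No pair of difference `p` has a geodesic meeting that of `(j, k)`. -/
def Avoids (γ : ℝ) (n p j k : ℕ) : Prop :=
  ∀ i : ℕ, 1 ≤ i → i + p ≤ n →
    geodesic (Int.fract ((i : ℝ) * γ)) (Int.fract (((i + p : ℕ) : ℝ) * γ)) ∩
      geodesic (Int.fract ((j : ℝ) * γ)) (Int.fract ((k : ℝ) * γ)) = ∅

section Avoids

variable {γ : ℝ} {n p j k : ℕ}

lemma Avoids.symm (h : Avoids γ n p j k) : Avoids γ n p k j := by
  intro i hi hn
  rw [geodesic_comm (Int.fract ((k : ℝ) * γ))]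
  exact h i hi hn

lemma Avoids.start_mul_nonpos (h : Avoids γ n p j k) {i : ℕ} (hi : 1 ≤ i) (hin : i + p ≤ n)
    (hij : Int.fract ((i : ℝ) * γ) = Int.fract ((j : ℝ) * γ)) :
    dispMul γ i (i + p) * dispMul γ j k ≤ 0 := by
  by_contra! hpos
  have h1 := h i hi hin
  unfold dispMul at hpos
  rw [hij] at h1 hpos
  exact (geodesic_inter_nonempty (Int.fract_nonneg _) (Int.fract_lt_one _) (Int.fract_nonneg _)
    (Int.fract_lt_one _) (Int.fract_nonneg _) (Int.fract_lt_one _) hpos).ne_empty h1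

lemma Avoids.end_mul_nonneg (h : Avoids γ n p j k) {i : ℕ} (hi : 1 ≤ i) (hin : i + p ≤ n)
    (hij : Int.fract (((i + p : ℕ) : ℝ) * γ) = Int.fract ((j : ℝ) * γ)) :
    0 ≤ dispMul γ i (i + p) * dispMul γ j k := by
  by_contra! hneg
  have h1 := h i hi hin
  have hpos : 0 < dispMul γ (i + p) i * dispMul γ j k := by
    rw [dispMul_antisymm γ i]
    linarith
  unfold dispMul at hpos
  rw [geodesic_comm, hij] at h1
  rw [hij] at hpos
  exact (geodesic_inter_nonempty (Int.fract_nonneg _) (Int.fract_lt_one _) (Int.fract_nonneg _)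
    (Int.fract_lt_one _) (Int.fract_nonneg _) (Int.fract_lt_one _) hpos).ne_empty h1

lemma Avoids.of_mul_pos (h : Avoids γ n p j k) (hj : 1 ≤ j) (hk : k ≤ n)
    (hp : |res γ p| < 1 / 2) (hpos : 0 < res γ p * dispMul γ j k) : n < j + p ∧ k ≤ p := by
  constructor
  · by_contra! hc
    have := h.start_mul_nonpos hj hc rfl
    rw [dispMul_add_eq_res j hp] at this
    linarith
  · by_contra! hc
    have e : k - p + p = k := Nat.sub_add_cancel hc.le
    have := h.symm.end_mul_nonneg (i := k - p) (by omega) (by omega) (by rw [e])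
    rw [dispMul_add_eq_res _ hp, dispMul_antisymm] at this
    linarith

lemma Avoids.of_mul_neg (h : Avoids γ n p j k) (hj : 1 ≤ j) (hjk : j < k) (hk : k ≤ n)
    (hp : |res γ p| < 1 / 2) (hneg : res γ p * dispMul γ j k < 0) : j ≤ p ∧ n < k + p := by
  constructor
  · by_contra! hc
    have e : j - p + p = j := Nat.sub_add_cancel hc.le
    have := h.end_mul_nonneg (i := j - p) (by omega) (by omega) (by rw [e])
    rw [dispMul_add_eq_res _ hp] at this
    linarith
  · by_contra! hc
    have := h.symm.start_mul_nonpos (by omega) hc rfl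
    rw [dispMul_add_eq_res _ hp, dispMul_antisymm] at this
    linarith

lemma Avoids.of_mul_ne_zero (h : Avoids γ n p j k) (hj : 1 ≤ j) (hjk : j < k) (hk : k ≤ n)
    (hp : |res γ p| < 1 / 2) (hne : res γ p * dispMul γ j k ≠ 0) : j ≤ p ∧ n < k + p := by
  rcases lt_or_gt_of_ne hne with h1 | h1
  · exact h.of_mul_neg hj hjk hk hp h1
  · have := h.of_mul_pos hj hk hp h1
    omega

lemma exists_modEq_mem_Icc {z : ℕ} (hz : 1 ≤ z) (hj : 1 ≤ j) :
    ∃ i, 1 ≤ i ∧ i ≤ z ∧ i ≡ j [MOD z] := by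
  refine ⟨(j - 1) % z + 1, by omega, Nat.mod_lt _ hz, ?_⟩
  have : (j - 1) % z + 1 ≡ (j - 1) + 1 [MOD z] := (Nat.mod_modEq _ _).add_right 1
  rwa [Nat.sub_add_cancel hj] at this

lemma Avoids.lt_add_period (h : Avoids γ n p j k) (hj : 1 ≤ j) (hjk : j < k) {z : ℕ} (hz : 1 ≤ z)
    (hz0 : res γ z = 0) (hp : |res γ p| < 1 / 2) (hne : res γ p * dispMul γ j k ≠ 0) :
    n < p + z := by
  by_contra! hc
  obtain ⟨i, hi1, hiz, hij⟩ := exists_modEq_mem_Icc hz hj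
  obtain ⟨l, hl1, hlz, hlk⟩ := exists_modEq_mem_Icc hz (hj.trans hjk.le)
  have h1 := h.start_mul_nonpos hi1 (by omega) (fract_eq_of_modEq hz0 hij)
  have h2 := h.symm.start_mul_nonpos hl1 (by omega) (fract_eq_of_modEq hz0 hlk)
  rw [dispMul_add_eq_res _ hp] at h1 h2
  rw [dispMul_antisymm] at h2
  exact hne (by linarith)

lemma Avoids.lt_add_period_of_half (h : Avoids γ n p j k) (hj : 1 ≤ j) {z : ℕ}
    (hz : 1 ≤ z) (hz0 : res γ z = 0) (hp : |res γ p| = 1 / 2) (hjk : |dispMul γ j k| = 1 / 2) :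
    n < p + z := by
  by_contra! hc
  obtain ⟨i, hi1, hiz, hij⟩ := exists_modEq_mem_Icc hz hj
  have e := fract_eq_of_modEq hz0 hij
  have h1 := h.start_mul_nonpos hi1 (by omega) e
  have h2 := abs_dispMul_add γ i p
  unfold dispMul at h1 h2 hjk
  rw [e] at h1 h2
  have := disp_mul_disp_pos_of_half (Int.fract_nonneg _) (Int.fract_lt_one _) (Int.fract_nonneg _)
    (Int.fract_lt_one _) (Int.fract_nonneg _) (Int.fract_lt_one _) (h2.trans hp) hjk
  linarith

end Avoids

lemma len2_eq (α β : ℝ) (q : ℕ) : len2 α β q = √(res α q ^ 2 + res β q ^ 2) := by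
  simp only [len2, nint, res, sq_abs]

lemma len2_nonneg (α β : ℝ) (q : ℕ) : 0 ≤ len2 α β q := Real.sqrt_nonneg _

lemma len2_sq (α β : ℝ) (q : ℕ) : len2 α β q ^ 2 = res α q ^ 2 + res β q ^ 2 := by
  rw [len2_eq, Real.sq_sqrt (by positivity)]

lemma len2_comm (α β : ℝ) (q : ℕ) : len2 α β q = len2 β α q := by
  rw [len2_eq, len2_eq, add_comm]

lemma abs_res_left_le_len2 (α β : ℝ) (q : ℕ) : |res α q| ≤ len2 α β q :=
  abs_le_of_sq_le_sq (by rw [len2_sq]; exact le_add_of_nonneg_right (sq_nonneg _))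
    (len2_nonneg _ _ _)

lemma abs_res_right_le_len2 (α β : ℝ) (q : ℕ) : |res β q| ≤ len2 α β q := by
  rw [len2_comm]
  exact abs_res_left_le_len2 _ _ _

/-- The pair `(j, k)` is not defeated by any strictly shorter pair. -/
structure Undefeated (α β : ℝ) (n j k : ℕ) : Prop where
  one_le : 1 ≤ j
  lt : j < k
  le : k ≤ n
  avoids_left : ∀ p, 1 ≤ p → len2 α β p < len2 α β (k - j) → Avoids α n p j k
  avoids_right : ∀ p, 1 ≤ p → len2 α β p < len2 α β (k - j) → Avoids β n p j k

lemma Undefeated.swap {α β : ℝ} {n j k : ℕ} (h : Undefeated α β n j k) :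
    Undefeated β α n j k := by
  refine ⟨h.one_le, h.lt, h.le, fun p hp hl => h.avoids_right p hp ?_,
    fun p hp hl => h.avoids_left p hp ?_⟩ <;>
  rwa [len2_comm α β, len2_comm α β]

/-- `q` is the difference of an undefeated pair. -/
def Surviving (α β : ℝ) (n q : ℕ) : Prop := ∃ j, Undefeated α β n j (j + q)

lemma Surviving.one_le {α β : ℝ} {n q : ℕ} (h : Surviving α β n q) : 1 ≤ q := by
  obtain ⟨j, hj⟩ := h
  have := hj.lt
  omega

lemma Surviving.lt {α β : ℝ} {n q : ℕ} (h : Surviving α β n q) : q < n := by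
  obtain ⟨j, hj⟩ := h
  have := hj.one_le
  have := hj.le
  omega

lemma Surviving.swap {α β : ℝ} {n q : ℕ} (h : Surviving α β n q) : Surviving β α n q := by
  obtain ⟨j, hj⟩ := h
  exact ⟨j, hj.swap⟩

section Undefeated

variable {α β : ℝ} {n j k p : ℕ}

lemma Undefeated.of_pos (h : Undefeated α β n j k) (hp : 1 ≤ p) (hl : len2 α β p < len2 α β (k - j))
    (hα : |res α p| < 1 / 2) (hβ : |res β p| < 1 / 2)
    (hpos : 0 < res α p * dispMul α j k ∨ 0 < res β p * dispMul β j k) :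
    n < j + p ∧ k ≤ p := by
  rcases hpos with h1 | h1
  · exact (h.avoids_left p hp hl).of_mul_pos h.one_le h.le hα h1
  · exact (h.avoids_right p hp hl).of_mul_pos h.one_le h.le hβ h1

lemma Undefeated.of_ne_zero (h : Undefeated α β n j k) (hp : 1 ≤ p)
    (hl : len2 α β p < len2 α β (k - j)) (hα : |res α p| < 1 / 2) (hβ : |res β p| < 1 / 2)
    (hne : res α p * dispMul α j k ≠ 0 ∨ res β p * dispMul β j k ≠ 0) :
    j ≤ p ∧ n < k + p := by
  rcases hne with h1 | h1
  · exact (h.avoids_left p hp hl).of_mul_ne_zero h.one_le h.lt h.le hα h1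
  · exact (h.avoids_right p hp hl).of_mul_ne_zero h.one_le h.lt h.le hβ h1

lemma sq_le_add_sq_of_mul_nonneg {x y d : ℝ} (h1 : x * d ≤ 0) (h2 : y * d ≤ 0) (hd : d ≠ 0) :
    x ^ 2 ≤ (y + x) ^ 2 := by
  have : 0 ≤ (x * y) * d ^ 2 := by nlinarith
  have : 0 ≤ x * y := nonneg_of_mul_nonneg_left this (by positivity)
  nlinarith [sq_nonneg y]

lemma Undefeated.not_close (h : Undefeated α β n j k) {q₁ q₂ : ℕ} (h₂ : Surviving α β n q₂)
    (hq₁ : 1 ≤ q₁) (hq₁n : q₁ < n) (h₁₂ : len2 α β q₁ < len2 α β q₂)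
    (h₂₃ : len2 α β q₂ < len2 α β (k - j))
    (hα₁ : |res α q₁| < 1 / 2) (hβ₁ : |res β q₁| < 1 / 2)
    (hα₂ : |res α q₂| < 1 / 2) (hβ₂ : |res β q₂| < 1 / 2)
    (hα : |res α q₁ - res α q₂| < 1 / 2) (hβ : |res β q₁ - res β q₂| < 1 / 2)
    (hshare : 0 < res α q₁ * res α q₂ ∨ 0 < res β q₁ * res β q₂)
    (hclose : (res α q₁ - res α q₂) ^ 2 + (res β q₁ - res β q₂) ^ 2 ≤ len2 α β q₂ ^ 2)
    (hdα : dispMul α j k ≠ 0 ∨ (res α q₁ = 0 ∧ res α q₂ = 0))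
    (hdβ : dispMul β j k ≠ 0 ∨ (res β q₁ = 0 ∧ res β q₂ = 0)) : False := by
  have hq₂ := h₂.one_le
  have hlt : q₂ < q₁ := by
    obtain ⟨i, hi⟩ := h₂
    have := hi.one_le
    have := hi.of_pos hq₁ (by rwa [Nat.add_sub_cancel_left]) hα₁ hβ₁
      (by rwa [dispMul_add_eq_res i hα₂, dispMul_add_eq_res i hβ₂])
    omega
  obtain ⟨r, rfl⟩ : ∃ r, q₁ = q₂ + r := ⟨q₁ - q₂, by omega⟩
  have hr : 1 ≤ r := by omega
  have eα := res_sub hlt.le hα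
  have eβ := res_sub hlt.le hβ
  rw [Nat.add_sub_cancel_left] at eα eβ
  have hrl : len2 α β r ≤ len2 α β q₂ := by
    refine le_of_sq_le_sq ?_ (len2_nonneg _ _ _)
    rwa [len2_sq, eα, eβ]
  rw [← eα] at hα
  rw [← eβ] at hβ
  have hr₃ := hrl.trans_lt h₂₃
  have hsq : len2 α β (q₂ + r) ^ 2 < len2 α β q₂ ^ 2 :=
    pow_lt_pow_left₀ h₁₂ (len2_nonneg _ _ _) two_ne_zero
  have hne : res α q₂ * dispMul α j k ≠ 0 ∨ res β q₂ * dispMul β j k ≠ 0 := by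
    rcases hshare with hs | hs
    · have : res α q₂ ≠ 0 := by rintro e; simp [e] at hs
      exact Or.inl (mul_ne_zero this (hdα.resolve_right fun e => this e.2))
    · have : res β q₂ ≠ 0 := by rintro e; simp [e] at hs
      exact Or.inr (mul_ne_zero this (hdβ.resolve_right fun e => this e.2))
  have hrne : res α r * dispMul α j k ≠ 0 ∨ res β r * dispMul β j k ≠ 0 := by
    by_cases hrα : res α r = 0
    · have hrβ : res β r ≠ 0 := by
        intro hrβ
        rw [len2_sq, len2_sq, show res α (q₂ + r) = res α q₂ by linarith,
          show res β (q₂ + r) = res β q₂ by linarith] at hsq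
        exact lt_irrefl _ hsq
      refine Or.inr (mul_ne_zero hrβ (hdβ.resolve_right fun e => hrβ ?_))
      rw [eβ, e.1, e.2, sub_zero]
    · refine Or.inl (mul_ne_zero hrα (hdα.resolve_right fun e => hrα ?_))
      rw [eα, e.1, e.2, sub_zero]
  have B₂ := h.of_ne_zero hq₂ h₂₃ hα₂ hβ₂ hne
  have Br := h.of_ne_zero hr hr₃ hα hβ hrne
  by_cases hp₂ : 0 < res α q₂ * dispMul α j k ∨ 0 < res β q₂ * dispMul β j k
  · have := h.of_pos hq₂ h₂₃ hα₂ hβ₂ hp₂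
    omega
  by_cases hpr : 0 < res α r * dispMul α j k ∨ 0 < res β r * dispMul β j k
  · have := h.of_pos hr hr₃ hα hβ hpr
    omega
  push Not at hp₂ hpr
  have keyα : res α q₂ ^ 2 ≤ res α (q₂ + r) ^ 2 := by
    rcases hdα with hd | ⟨e1, e2⟩
    · have := sq_le_add_sq_of_mul_nonneg hp₂.1 hpr.1 hd
      rwa [show res α r + res α q₂ = res α (q₂ + r) by linarith] at this
    · rw [e1, e2]
  have keyβ : res β q₂ ^ 2 ≤ res β (q₂ + r) ^ 2 := by
    rcases hdβ with hd | ⟨e1, e2⟩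
    · have := sq_le_add_sq_of_mul_nonneg hp₂.2 hpr.2 hd
      rwa [show res β r + res β q₂ = res β (q₂ + r) by linarith] at this
    · rw [e1, e2]
  rw [len2_sq, len2_sq] at hsq
  linarith

end Undefeated

/-- The label of the octant containing `(x, y)`. -/
noncomputable def octant (x y : ℝ) : Bool × Bool × Bool :=
  (decide (0 < x), decide (0 < y), decide (|x| ≤ |y|))

lemma octant_close {x y x' y' : ℝ} (h : octant x y = octant x' y')
    (hle : x ^ 2 + y ^ 2 ≤ x' ^ 2 + y' ^ 2) :
    (x - x') ^ 2 + (y - y') ^ 2 ≤ x' ^ 2 + y' ^ 2 := by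
  simp only [octant, Prod.mk.injEq, decide_eq_decide] at h
  obtain ⟨h1, h2, h3⟩ := h
  have mx : 0 ≤ x * x' := by
    by_cases hx : 0 < x
    · exact (mul_pos hx (h1.1 hx)).le
    · exact mul_nonneg_of_nonpos_of_nonpos (not_lt.1 hx) (not_lt.1 (mt h1.2 hx))
  have my : 0 ≤ y * y' := by
    by_cases hy : 0 < y
    · exact (mul_pos hy (h2.1 hy)).le
    · exact mul_nonneg_of_nonpos_of_nonpos (not_lt.1 hy) (not_lt.1 (mt h2.2 hy))
  have ex : x * x' = |x| * |x'| := by rw [← abs_mul, abs_of_nonneg mx]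
  have ey : y * y' = |y| * |y'| := by rw [← abs_mul, abs_of_nonneg my]
  have key : ∀ a b a' b' : ℝ, 0 ≤ a → 0 ≤ b → 0 ≤ a' → 0 ≤ b' → a ≤ b → a' ≤ b' →
      a ^ 2 + b ^ 2 ≤ a' ^ 2 + b' ^ 2 → a ^ 2 + b ^ 2 ≤ 2 * (a * a' + b * b') := by
    intro a b a' b' ha hb ha' hb' hab hab' hl
    rcases le_total b b' with hbb | hbb
    · nlinarith [mul_nonneg ha ha', mul_le_mul hab hab ha hb, mul_le_mul_of_nonneg_left hbb hb]
    · have : a ≤ a' := by nlinarith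
      nlinarith [mul_le_mul_of_nonneg_left this ha, mul_nonneg hb (sub_nonneg.2 hab'),
        mul_nonneg hb hb', mul_nonneg ha (sub_nonneg.2 this)]
  have : x ^ 2 + y ^ 2 ≤ 2 * (x * x' + y * y') := by
    rw [ex, ey, ← sq_abs x, ← sq_abs y]
    rw [← sq_abs x, ← sq_abs y, ← sq_abs x', ← sq_abs y'] at hle
    by_cases hxy : |x| ≤ |y|
    · exact key _ _ _ _ (abs_nonneg _) (abs_nonneg _) (abs_nonneg _) (abs_nonneg _) hxy
        (h3.1 hxy) hle
    · have := key |y| |x| |y'| |x'| (abs_nonneg _) (abs_nonneg _) (abs_nonneg _) (abs_nonneg _)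
        (not_le.1 hxy).le (not_le.1 (mt h3.2 hxy)).le (by linarith)
      linarith
  nlinarith

lemma octant_share {x y x' y' : ℝ} (h : octant x y = octant x' y') (h0 : 0 < x ^ 2 + y ^ 2)
    (h0' : 0 < x' ^ 2 + y' ^ 2) : 0 < x * x' ∨ 0 < y * y' := by
  have pos : ∀ a a' : ℝ, (0 < a ↔ 0 < a') → a ≠ 0 → a' ≠ 0 → 0 < a * a' := by
    intro a a' h ha ha'
    by_cases hx : 0 < a
    · exact mul_pos hx (h.1 hx)
    · exact mul_pos_of_neg_of_neg (lt_of_le_of_ne (not_lt.1 hx) ha)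
        (lt_of_le_of_ne (not_lt.1 (mt h.2 hx)) ha')
  have ne : ∀ a b : ℝ, 0 < a ^ 2 + b ^ 2 → |a| ≤ |b| → b ≠ 0 := by
    rintro a b hab hle rfl
    rw [abs_zero] at hle
    rw [abs_nonpos_iff.1 hle] at hab
    norm_num at hab
  simp only [octant, Prod.mk.injEq, decide_eq_decide] at h
  obtain ⟨h1, h2, h3⟩ := h
  by_cases hxy : |x| ≤ |y|
  · exact Or.inr (pos _ _ h2 (ne _ _ h0 hxy) (ne _ _ h0' (h3.1 hxy)))
  · exact Or.inl (pos _ _ h1 (ne _ _ (by rwa [add_comm]) (not_le.1 hxy).le)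
      (ne _ _ (by rwa [add_comm]) (not_le.1 (mt h3.2 hxy)).le))

lemma abs_sub_lt_half {a a' : ℝ} (h : 0 < a ↔ 0 < a') (ha : |a| < 1 / 2) (ha' : |a'| < 1 / 2) :
    |a - a'| < 1 / 2 := by
  rw [abs_lt] at *
  by_cases hx : 0 < a
  · have := h.1 hx
    constructor <;> linarith
  · have := mt h.2 hx
    rw [not_lt] at *
    constructor <;> linarith

lemma Undefeated.octant_ne {α β : ℝ} {n j k q₁ q₂ : ℕ} (h : Undefeated α β n j k)
    (h₁ : Surviving α β n q₁) (h₂ : Surviving α β n q₂) (h₀ : 0 < len2 α β q₁)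
    (h₁₂ : len2 α β q₁ < len2 α β q₂) (h₂₃ : len2 α β q₂ < len2 α β (k - j))
    (hα₁ : |res α q₁| < 1 / 2) (hβ₁ : |res β q₁| < 1 / 2)
    (hα₂ : |res α q₂| < 1 / 2) (hβ₂ : |res β q₂| < 1 / 2)
    (hdα : dispMul α j k ≠ 0 ∨ (res α q₁ = 0 ∧ res α q₂ = 0))
    (hdβ : dispMul β j k ≠ 0 ∨ (res β q₁ = 0 ∧ res β q₂ = 0)) :
    octant (res α q₁) (res β q₁) ≠ octant (res α q₂) (res β q₂) := by
  intro he
  have hs₁ : 0 < res α q₁ ^ 2 + res β q₁ ^ 2 := by rw [← len2_sq]; positivity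
  have hs : res α q₁ ^ 2 + res β q₁ ^ 2 ≤ res α q₂ ^ 2 + res β q₂ ^ 2 := by
    rw [← len2_sq, ← len2_sq]
    exact (pow_lt_pow_left₀ h₁₂ h₀.le two_ne_zero).le
  have he' := he
  simp only [octant, Prod.mk.injEq, decide_eq_decide] at he'
  exact h.not_close h₂ h₁.one_le h₁.lt h₁₂ h₂₃ hα₁ hβ₁ hα₂ hβ₂ (abs_sub_lt_half he'.1 hα₁ hα₂)
    (abs_sub_lt_half he'.2.1 hβ₁ hβ₂) (octant_share he hs₁ (hs₁.trans_le hs))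
    (by rw [len2_sq]; exact octant_close he hs) hdα hdβ

lemma hex_close {s t s' t' : ℝ} (hs : 0 ≤ s) (ht : 0 ≤ t) (hs' : 0 ≤ s') (ht' : 0 ≤ t')
    (hle : s ^ 2 + s * t + t ^ 2 ≤ s' ^ 2 + s' * t' + t' ^ 2) :
    (s - s') ^ 2 + (s - s') * (t - t') + (t - t') ^ 2 ≤ s' ^ 2 + s' * t' + t' ^ 2 := by
  have h1 := mul_nonneg hs ht
  have h2 := mul_nonneg hs' ht'
  have mixed : ∀ a b c d : ℝ, 0 ≤ c → c ≤ a → 0 ≤ d → d ≤ b →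
      a ^ 2 ≤ s' ^ 2 + s' * t' + t' ^ 2 → b ^ 2 ≤ s' ^ 2 + s' * t' + t' ^ 2 →
      c ^ 2 - c * d + d ^ 2 ≤ s' ^ 2 + s' * t' + t' ^ 2 := by
    intro a b c d hc hca hd hdb ha hb
    rcases le_total c d with h | h
    · nlinarith [mul_nonneg hc (sub_nonneg.2 h)]
    · nlinarith [mul_nonneg hd (sub_nonneg.2 h)]
  rcases le_total s s' with u | u <;> rcases le_total t t' with v | v
  · nlinarith [mul_nonneg hs hs', mul_nonneg ht ht', mul_nonneg hs (sub_nonneg.2 u),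
      mul_nonneg ht (sub_nonneg.2 v), mul_nonneg hs (sub_nonneg.2 v),
      mul_nonneg ht (sub_nonneg.2 u)]
  · have := mixed s' t (s' - s) (t - t') (by linarith) (by linarith) (by linarith) (by linarith)
      (by nlinarith) (by nlinarith)
    linarith
  · have := mixed s t' (s - s') (t' - t) (by linarith) (by linarith) (by linarith) (by linarith)
      (by nlinarith) (by nlinarith)
    linarith
  · nlinarith [mul_nonneg hs' (sub_nonneg.2 u), mul_nonneg ht' (sub_nonneg.2 v),
      mul_nonneg hs' (sub_nonneg.2 v), mul_nonneg ht' (sub_nonneg.2 u)]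

/-- The label of the sector of angle `π / 3` containing `(x, y)`. -/
noncomputable def sextant (x y : ℝ) : Bool × Fin 3 :=
  (decide (0 < y), if |y| ≤ √3 * x then 0 else if |y| ≤ -(√3 * x) then 1 else 2)

lemma sextant_close {x y x' y' : ℝ} (h : sextant x y = sextant x' y')
    (hle : x ^ 2 + y ^ 2 ≤ x' ^ 2 + y' ^ 2) :
    (x - x') ^ 2 + (y - y') ^ 2 ≤ x' ^ 2 + y' ^ 2 := by
  simp only [sextant, Prod.mk.injEq, decide_eq_decide] at h
  obtain ⟨h1, h2⟩ := h
  have my : 0 ≤ y * y' := by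
    by_cases hy : 0 < y
    · exact (mul_pos hy (h1.1 hy)).le
    · exact mul_nonneg_of_nonpos_of_nonpos (not_lt.1 hy) (not_lt.1 (mt h1.2 hy))
  have ey : y * y' = |y| * |y'| := by rw [← abs_mul, abs_of_nonneg my]
  have h3 : √3 ^ 2 = 3 := Real.sq_sqrt (by norm_num)
  have hex : ∀ t : ℝ, t ^ 2 = (√3 * t) ^ 2 / 3 := by intro t; rw [mul_pow, h3]; ring
  have hexm : x * x' = (√3 * x) * (√3 * x') / 3 := by
    rw [show (√3 * x) * (√3 * x') = √3 ^ 2 * (x * x') by ring, h3]; ring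
  have goal : x ^ 2 + y ^ 2 ≤ 2 * (x * x' + y * y') := by
    rw [hexm, ey, ← sq_abs y, hex x]
    rw [← sq_abs y, ← sq_abs y', hex x, hex x'] at hle
    have p := abs_nonneg y
    have p' := abs_nonneg y'
    generalize √3 * x = a at *
    generalize √3 * x' = a' at *
    generalize |y| = b at *
    generalize |y'| = b' at *
    by_cases c1 : b ≤ a
    · have c1' : b' ≤ a' := by by_contra hc; simp [c1, hc] at h2; split_ifs at h2 <;> simp at h2
      have := hex_close (s := 2 * b) (t := a - b) (s' := 2 * b') (t' := a' - b') (by linarith)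
        (by linarith) (by linarith) (by linarith) (by linarith)
      linarith
    have c1' : ¬b' ≤ a' := by intro hc; simp [c1, hc] at h2; split_ifs at h2 <;> simp at h2
    by_cases c2 : b ≤ -a
    · have c2' : b' ≤ -a' := by by_contra hc; simp [c1, c1', c2, hc] at h2
      have := hex_close (s := 2 * b) (t := -a - b) (s' := 2 * b') (t' := -a' - b') (by linarith)
        (by linarith) (by linarith) (by linarith) (by linarith)
      linarith
    · have c2' : ¬b' ≤ -a' := by intro hc; simp [c1, c1', c2, hc] at h2
      have := hex_close (s := b + a) (t := b - a) (s' := b' + a') (t' := b' - a') (by linarith)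
        (by linarith) (by linarith) (by linarith) (by linarith)
      linarith
  linarith

lemma exists_multiple_short_aux {f g : ℝ} (hg : 0 ≤ g) (hgf : g ≤ f) (hf : f ≤ 1 / 2)
    (h1 : 1 / 4 ≤ f ^ 2 + g ^ 2) (h2 : 1 / 4 ≤ (2 * f - 1) ^ 2 + (2 * g) ^ 2)
    (h3 : 1 / 4 ≤ (2 * f - 1) ^ 2 + (2 * g - 1) ^ 2)
    (h4 : 1 / 4 ≤ (4 * f - 2) ^ 2 + (4 * g - 1) ^ 2) : False := by
  obtain ⟨e, rfl⟩ : ∃ e, f = (1 - e) / 2 := ⟨1 - 2 * f, by ring⟩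
  have he : 0 ≤ e := by linarith
  have he3 : e ≤ 3 / 10 := by
    have : g ^ 2 ≤ ((1 - e) / 2) ^ 2 := pow_le_pow_left₀ hg hgf 2
    by_contra hc
    nlinarith only [this, h1, hf, hc, he, hg, hgf]
  rcases le_total g (1 / 4) with h | h
  · obtain ⟨u, rfl⟩ : ∃ u, g = 1 / 4 - u / 2 := ⟨1 / 2 - 2 * g, by ring⟩
    have hu : 0 ≤ u := by linarith
    have hu2 : u ≤ 1 / 2 := by linarith
    have p : u ^ 2 ≤ u * (1 / 2) := by rw [sq]; exact mul_le_mul_of_nonneg_left hu2 hu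
    have p2 : e ^ 2 ≤ e * (3 / 10) := by rw [sq]; exact mul_le_mul_of_nonneg_left he3 he
    have e1 : e ≤ 3 / 20 := by ring_nf at h1; linarith
    have p3 : e ^ 2 ≤ (3 / 20) ^ 2 := pow_le_pow_left₀ he e1 2
    have e2 : u ≤ 1 / 20 := by ring_nf at h2; linarith
    have p4 : u ^ 2 ≤ (1 / 20) ^ 2 := pow_le_pow_left₀ hu e2 2
    ring_nf at h4
    linarith
  · obtain ⟨u, rfl⟩ : ∃ u, g = 1 / 4 + u / 2 := ⟨2 * g - 1 / 2, by ring⟩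
    have hu : 0 ≤ u := by linarith
    have hue : u ≤ 1 / 2 - e := by linarith
    have e1 : u - u ^ 2 ≤ e ^ 2 := by ring_nf at h3; linarith
    have e2 : 1 / 16 ≤ e ^ 2 + u ^ 2 := by ring_nf at h4; linarith
    have e3 : 1 ≤ (1 - e) ^ 2 + (1 / 2 + u) ^ 2 := by ring_nf at h1 ⊢; linarith
    clear h1 h2 h3 h4
    rcases le_total e (1 / 4) with h5 | h5
    · have p : e ^ 2 ≤ e * (1 / 4) := by rw [sq]; exact mul_le_mul_of_nonneg_left h5 he
      have p2 : u ^ 2 ≤ u * (1 / 2 - e) := by rw [sq]; exact mul_le_mul_of_nonneg_left hue hu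
      have c1 : u ≤ 1 / 8 := by nlinarith only [p, p2, e1, hu, he, h5]
      have p3 : u ^ 2 ≤ u * (1 / 8) := by rw [sq]; exact mul_le_mul_of_nonneg_left c1 hu
      have c2 : u ≤ 1 / 14 := by linarith
      have p4 : u ^ 2 ≤ (1 / 14) ^ 2 := pow_le_pow_left₀ hu c2 2
      have c3 : 21 / 100 ≤ e := by
        by_contra hc
        have := pow_le_pow_left₀ he (not_le.1 hc).le 2
        linarith
      have p5 := pow_le_pow_left₀ (by linarith : 0 ≤ 1 - e) (by linarith : 1 - e ≤ 79 / 100) 2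
      have p6 := pow_le_pow_left₀ (by linarith : 0 ≤ 1 / 2 + u)
        (by linarith : 1 / 2 + u ≤ 1 / 2 + 1 / 14) 2
      norm_num at p5 p6
      linarith
    · have p5 := pow_le_pow_left₀ (by linarith : 0 ≤ 1 - e) (by linarith : 1 - e ≤ 3 / 4) 2
      have c1 : 4 / 25 ≤ u := by
        by_contra hc
        have := pow_le_pow_left₀ (by linarith : 0 ≤ 1 / 2 + u)
          (by linarith : 1 / 2 + u ≤ 1 / 2 + 4 / 25) 2
        norm_num at this p5
        linarith
      have p : e ^ 2 ≤ (3 / 10) ^ 2 := pow_le_pow_left₀ he he3 2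
      have p3 : u ^ 2 ≤ u * (1 / 4) := by
        rw [sq]; exact mul_le_mul_of_nonneg_left (by linarith) hu
      norm_num at p
      linarith

lemma abs_res_mul_le (γ : ℝ) (c : ℕ) (m : ℤ) : |res γ c| ≤ |c * |res γ 1| - m| := by
  have key : ∀ l : ℤ, |res γ c| ≤ |(c : ℝ) * γ - l| := fun l => round_le _ _
  have e : γ = res γ 1 + (round (((1 : ℕ) : ℝ) * γ) : ℤ) := by unfold res; push_cast; ring
  generalize (round (((1 : ℕ) : ℝ) * γ) : ℤ) = r at e
  rcases abs_cases (res γ 1) with ⟨h, -⟩ | ⟨h, -⟩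
  · refine (key (c * r + m)).trans (le_of_eq ?_)
    rw [h]
    nth_rw 1 [e]
    push_cast
    ring_nf
  · refine (key (c * r - m)).trans (le_of_eq ?_)
    rw [h, ← abs_neg]
    nth_rw 1 [e]
    push_cast
    ring_nf

lemma exists_multiple_short (α β : ℝ) : ∃ s : ℕ, 1 ≤ s ∧ s ≤ 4 ∧ len2 α β s < 1 / 2 := by
  by_contra! hc
  have key : ∀ s : ℕ, 1 ≤ s → s ≤ 4 → ∀ m l : ℤ,
      1 / 4 ≤ (s * |res α 1| - m) ^ 2 + (s * |res β 1| - l) ^ 2 := by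
    intro s h1 h4 m l
    have h5 := hc s h1 h4
    have h6 : (1 / 2) ^ 2 ≤ len2 α β s ^ 2 := pow_le_pow_left₀ (by norm_num) h5 2
    rw [len2_sq] at h6
    have h7 := sq_le_sq.2 (abs_res_mul_le α s m)
    have h8 := sq_le_sq.2 (abs_res_mul_le β s l)
    linarith
  have k1 := key 1 (by norm_num) (by norm_num) 0 0
  have k2 := fun m l => key 2 (by norm_num) (by norm_num) m l
  have k4 := fun m l => key 4 (by norm_num) (by norm_num) m l
  have a1 := abs_res_le α 1
  have b1 := abs_res_le β 1
  have a0 := abs_nonneg (res α 1)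
  have b0 := abs_nonneg (res β 1)
  have k20 := k2 1 0
  have k21 := k2 0 1
  have k22 := k2 1 1
  have k40 := k4 2 1
  have k41 := k4 1 2
  push_cast at *
  rcases le_total |res β 1| |res α 1| with h | h
  · exact exists_multiple_short_aux b0 h a1 (by linarith) (by linarith) (by linarith) (by linarith)
  · exact exists_multiple_short_aux a0 h b1 (by linarith) (by linarith) (by linarith) (by linarith)

lemma Undefeated.res_eq_zero_of_long {α β : ℝ} {n j k z s : ℕ} (h : Undefeated α β n j k)
    (hl : 1 / 2 ≤ len2 α β (k - j)) (hd : dispMul β j k ≠ 0) (hz : 1 ≤ z) (hz0 : res β z = 0)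
    (hs : 1 ≤ s) (hsz : s + z ≤ n) (hs2 : len2 α β s < 1 / 2) : res β s = 0 := by
  by_contra hne
  have := (h.avoids_right s hs (hs2.trans_le hl)).lt_add_period h.one_le h.lt hz hz0
    ((abs_res_right_le_len2 _ _ _).trans_lt hs2) (mul_ne_zero hne hd)
  omega

lemma dispMul_ne_zero {γ : ℝ} {j q : ℕ} (h : res γ q ≠ 0) : dispMul γ j (j + q) ≠ 0 := by
  rw [← abs_pos, abs_dispMul_add, abs_pos]
  exact h

section Count

lemma card_image_le_of_color {κ : Type*} [DecidableEq κ] (f : ℕ → ℝ) (c : ℕ → κ) (F : Finset ℕ)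
    (h : ∀ p ∈ F, ∀ q ∈ F, f p < f q → c p ≠ c q) : (F.image f).card ≤ (F.image c).card := by
  classical
  have hinj : ∀ p ∈ F, ∀ q ∈ F, c p = c q → f p = f q := by
    intro p hp q hq hc
    rcases lt_trichotomy (f p) (f q) with h1 | h1 | h1
    · exact absurd hc (h p hp q hq h1)
    · exact h1
    · exact absurd hc.symm (h q hq p hp h1)
  have hchoose : ∀ x ∈ F.image f, ∃ p ∈ F, f p = x := fun x hx => Finset.mem_image.1 hx
  choose! g hg hfg using hchoose
  refine Finset.card_le_card_of_injOn (c ∘ g) (fun x hx => Finset.mem_image_of_mem c (hg x hx)) ?_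
  intro x hx y hy hxy
  rw [← hfg x hx, ← hfg y hy]
  exact hinj _ (hg x hx) _ (hg y hy) hxy

lemma card_image_le_succ (f : ℕ → ℝ) (F : Finset ℕ) (m : ℕ)
    (h : ∀ q ∈ F, (∀ p ∈ F, f p ≤ f q) → ((F.filter fun p => f p < f q).image f).card ≤ m) :
    (F.image f).card ≤ m + 1 := by
  classical
  rcases F.eq_empty_or_nonempty with rfl | hF
  · simp
  obtain ⟨q, hq, hmax⟩ := F.exists_max_image f hF
  refine le_trans (Finset.card_le_card ?_)
    ((Finset.card_insert_le (f q) _).trans (Nat.succ_le_succ (h q hq hmax)))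
  intro x hx
  obtain ⟨p, hp, rfl⟩ := Finset.mem_image.1 hx
  rcases lt_or_eq_of_le (hmax p hp) with h1 | h1
  · exact Finset.mem_insert_of_mem (Finset.mem_image_of_mem f (Finset.mem_filter.2 ⟨hp, h1⟩))
  · exact Finset.mem_insert.2 (Or.inl h1)

lemma card_image_filter_add (f : ℕ → ℝ) (F : Finset ℕ) (P : ℕ → Prop) [DecidablePred P] :
    (F.image f).card ≤
      ((F.filter P).image f).card + ((F.filter fun p => ¬P p).image f).card := by
  classical
  rw [← Finset.filter_union_filter_not_eq P F, Finset.image_union]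
  refine (Finset.card_union_le _ _).trans (le_of_eq ?_)
  rw [Finset.filter_union_filter_not_eq]

lemma card_image_le_one (f : ℕ → ℝ) (F : Finset ℕ) (h : ∀ p ∈ F, ∀ q ∈ F, f p = f q) :
    (F.image f).card ≤ 1 := by
  classical
  rw [Finset.card_le_one]
  intro x hx y hy
  obtain ⟨p, hp, rfl⟩ := Finset.mem_image.1 hx
  obtain ⟨q, hq, rfl⟩ := Finset.mem_image.1 hy
  exact h p hp q hq

end Count

section Periodic

variable {α β : ℝ} {n b : ℕ} {F : Finset ℕ}

lemma card_image_len2_le_four (hF : ∀ q ∈ F, Surviving α β n q) (h0 : ∀ q ∈ F, res β q = 0) :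
    (F.image (len2 α β)).card ≤ 4 := by
  classical
  refine card_image_le_succ _ _ 3 fun q hq _ => ?_
  refine (card_image_filter_add _ _ fun p => len2 α β p = 0).trans ?_
  refine Nat.add_le_add (b := 1) (d := 2) (card_image_le_one _ _ ?_) ?_
  · intro p hp p' hp'
    rw [(Finset.mem_filter.1 hp).2, (Finset.mem_filter.1 hp').2]
  have hmem : ∀ p ∈ ((F.filter fun p => len2 α β p < len2 α β q).filter
      fun p => ¬len2 α β p = 0), p ∈ F ∧ len2 α β p < len2 α β q ∧ 0 < len2 α β p ∧
        |res α p| < 1 / 2 ∧ |res β p| < 1 / 2 ∧ res α p ≠ 0 := by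
    intro p hp
    simp only [Finset.mem_filter] at hp
    obtain ⟨⟨hp, hlt⟩, hne⟩ := hp
    have habs : ∀ p ∈ F, len2 α β p = |res α p| := fun p hp => by
      rw [len2_eq, h0 p hp, sq (0 : ℝ), mul_zero, add_zero, Real.sqrt_sq_eq_abs]
    refine ⟨hp, hlt, (len2_nonneg _ _ _).lt_of_ne' hne, ?_, ?_, ?_⟩
    · rw [← habs p hp]
      exact hlt.trans_le ((habs q hq).trans_le (abs_res_le _ _))
    · rw [h0 p hp, abs_zero]
      norm_num
    · rintro h
      rw [habs p hp, h, abs_zero] at hne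
      exact hne rfl
  refine (card_image_le_of_color _ (fun p => octant (res α p) (res β p)) _ ?_).trans ?_
  · intro p hp p' hp' hlt
    obtain ⟨hpF, hpq, hp0, hpα, hpβ, hne⟩ := hmem p hp
    obtain ⟨hpF', hpq', hp0', hpα', hpβ', hne'⟩ := hmem p' hp'
    obtain ⟨j, hj⟩ := hF q hq
    have hqα : res α q ≠ 0 := by
      intro h
      rw [len2_eq α β q, h, h0 q hq] at hpq
      norm_num at hpq
      exact absurd hpq (len2_nonneg _ _ _).not_gt
    exact hj.octant_ne (hF p hpF) (hF p' hpF') hp0 hlt (by rwa [Nat.add_sub_cancel_left])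
      hpα hpβ hpα' hpβ' (Or.inl (dispMul_ne_zero hqα)) (Or.inr ⟨h0 p hpF, h0 p' hpF'⟩)
  · refine (Finset.card_le_card (t := {(true, false, false), (false, false, false)}) ?_).trans
      Finset.card_le_two
    intro x hx
    obtain ⟨p, hp, rfl⟩ := Finset.mem_image.1 hx
    obtain ⟨hpF, -, -, -, -, hne⟩ := hmem p hp
    by_cases hpos : 0 < res α p <;> simp [octant, h0 p hpF, hne, hpos]

lemma card_image_len2_le_of_period (hF : ∀ q ∈ F, Surviving α β n q) (h0 : ∀ q ∈ F, res β q ≠ 0)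
    (hb : 1 ≤ b) (hbn : b ≤ n) (hb0 : res β b = 0) (hmin : ∀ p, 1 ≤ p → p < b → res β p ≠ 0) :
    (F.image (len2 α β)).card ≤ b + 2 := by
  classical
  refine (card_image_filter_add _ _ fun p => |res β p| = 1 / 2).trans ?_
  rw [add_comm b 2]
  refine Nat.add_le_add ?_ ?_
  · refine card_image_le_succ _ _ 1 fun q hq _ => card_image_le_one _ _ fun p hp p' hp' => ?_
    have hwin : ∀ p ∈ ((F.filter fun p => |res β p| = 1 / 2).filter
        fun p => len2 α β p < len2 α β q), p < n ∧ n < p + b ∧ |res β p| = 1 / 2 := by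
      intro p hp
      simp only [Finset.mem_filter] at hp hq
      obtain ⟨j, hj⟩ := hF q hq.1
      have hp1 := hF p hp.1.1
      refine ⟨hp1.lt, ?_, hp.1.2⟩
      exact (hj.avoids_right p hp1.one_le (by rw [Nat.add_sub_cancel_left]; exact hp.2)
        ).lt_add_period_of_half hj.one_le hb hb0 hp.1.2 (by rw [abs_dispMul_add]; exact hq.2)
    obtain ⟨h1, h2, h3⟩ := hwin p hp
    obtain ⟨h1', h2', h3'⟩ := hwin p' hp'
    congr 1
    by_contra hne
    rcases lt_or_gt_of_ne hne with h | h
    · exact hmin (p' - p) (by omega) (by omega) (res_sub_eq_zero_of_half h.le h3' h3)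
    · exact hmin (p - p') (by omega) (by omega) (res_sub_eq_zero_of_half h.le h3 h3')
  · obtain ⟨c, rfl⟩ : ∃ c, b = c + 1 := ⟨b - 1, by omega⟩
    refine card_image_le_succ _ _ c fun q hq _ => Finset.card_image_le.trans ?_
    refine (Finset.card_le_card (t := Finset.Ioo (n - (c + 1)) n) fun p hp => ?_).trans ?_
    · simp only [Finset.mem_filter] at hp hq
      obtain ⟨j, hj⟩ := hF q hq.1
      have hp1 := hF p hp.1.1
      have := (hj.avoids_right p hp1.one_le (by rw [Nat.add_sub_cancel_left]; exact hp.2)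
        ).lt_add_period hj.one_le hj.lt hb hb0 ((abs_res_le _ _).lt_of_ne hp.1.2)
        (mul_ne_zero (h0 p hp.1.1) (dispMul_ne_zero (h0 q hq.1)))
      have := hp1.lt
      rw [Finset.mem_Ioo]
      omega
    · rw [Nat.card_Ioo]
      omega

lemma card_image_len2_le_seven (hF : ∀ q ∈ F, Surviving α β n q) (h0 : ∀ q ∈ F, res β q ≠ 0)
    (hb : 1 ≤ b) (hbn : 2 * b ≤ n) (hb0 : res β b = 0)
    (hmin : ∀ p, 1 ≤ p → p < b → res β p ≠ 0) (hlen : ∀ q ∈ F, len2 α β q < 1 / 2) :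
    (F.image (len2 α β)).card ≤ 7 := by
  classical
  refine card_image_le_succ _ _ 6 fun q hq _ => ?_
  have hwin : ∀ p, 1 ≤ p → len2 α β p < len2 α β q → res β p ≠ 0 → n < p + b := by
    intro p hp hlt hne
    obtain ⟨j, hj⟩ := hF q hq
    exact (hj.avoids_right p hp (by rwa [Nat.add_sub_cancel_left])).lt_add_period
      hj.one_le hj.lt hb hb0 ((abs_res_right_le_len2 α β p).trans_lt (hlt.trans (hlen q hq)))
      (mul_ne_zero hne (dispMul_ne_zero (h0 q hq)))
  refine (card_image_le_of_color _ (fun p => sextant (res α p) (res β p)) _ ?_).trans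
    ((Finset.card_le_univ _).trans (by simp))
  intro p hp p' hp' hlt he
  rw [Finset.mem_filter] at hp hp'
  have hpn := (hF p hp.1).lt
  have hpn' := (hF p' hp'.1).lt
  have w := hwin p (hF p hp.1).one_le hp.2 (h0 p hp.1)
  have w' := hwin p' (hF p' hp'.1).one_le hp'.2 (h0 p' hp'.1)
  have hsq := pow_le_pow_left₀ (len2_nonneg _ _ _) hlt.le 2
  rw [len2_sq, len2_sq] at hsq
  have hclose := sextant_close he hsq
  obtain ⟨r, hr, hrb, hrl⟩ : ∃ r, 1 ≤ r ∧ r < b ∧ len2 α β r ≤ len2 α β p' := by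
    have key : ∀ r, |res α r| ≤ |res α p - res α p'| → |res β r| ≤ |res β p - res β p'| →
        len2 α β r ≤ len2 α β p' := by
      intro r h1 h2
      refine le_of_sq_le_sq ?_ (len2_nonneg _ _ _)
      rw [len2_sq, len2_sq]
      have := sq_le_sq.2 h1
      have := sq_le_sq.2 h2
      linarith
    rcases lt_trichotomy p p' with h | h | h
    · refine ⟨p' - p, by omega, by omega, key _ ?_ ?_⟩ <;> rw [abs_sub_comm] <;>
        exact abs_res_sub_le _ h.le
    · exact absurd hlt (by rw [h]; exact lt_irrefl _)
    · exact ⟨p - p', by omega, by omega,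
        key _ (abs_res_sub_le _ h.le) (abs_res_sub_le _ h.le)⟩
  have := hwin r hr (hrl.trans_lt hp'.2) (hmin r hr hrb)
  omega

lemma card_image_len2_le_of_exists_period (hF : ∀ q ∈ F, Surviving α β n q) (hn : 13 ≤ n)
    (hz : ∃ z, 1 ≤ z ∧ 2 * z ≤ n ∧ res β z = 0) : (F.image (len2 α β)).card ≤ 11 := by
  classical
  have hz' : ∃ z, 1 ≤ z ∧ res β z = 0 := hz.imp fun z h => ⟨h.1, h.2.2⟩
  obtain ⟨hb, hb0⟩ := Nat.find_spec hz'
  have hbn : 2 * Nat.find hz' ≤ n := by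
    obtain ⟨z, h1, h2, h3⟩ := hz
    have := Nat.find_min' hz' ⟨h1, h3⟩
    omega
  have hmin : ∀ p, 1 ≤ p → p < Nat.find hz' → res β p ≠ 0 :=
    fun p hp hlt h => Nat.find_min hz' hlt ⟨hp, h⟩
  generalize Nat.find hz' = b at *
  refine (card_image_filter_add _ _ fun p => res β p = 0).trans ?_
  refine Nat.add_le_add (b := 4) (d := 7) (card_image_len2_le_four (n := n) ?_ ?_) ?_
  · exact fun q hq => hF q (Finset.mem_filter.1 hq).1
  · exact fun q hq => (Finset.mem_filter.1 hq).2
  have hF' : ∀ q ∈ F.filter fun p => ¬res β p = 0, Surviving α β n q :=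
    fun q hq => hF q (Finset.mem_filter.1 hq).1
  have h0 : ∀ q ∈ F.filter fun p => ¬res β p = 0, res β q ≠ 0 :=
    fun q hq => (Finset.mem_filter.1 hq).2
  by_cases hb5 : b ≤ 5
  · exact (card_image_len2_le_of_period hF' h0 hb (by omega) hb0 hmin).trans (by omega)
  refine card_image_len2_le_seven hF' h0 hb hbn hb0 hmin fun q hq => ?_
  by_contra! hl
  obtain ⟨s, hs, hs4, hsl⟩ := exists_multiple_short α β
  obtain ⟨j, hj⟩ := hF' q hq
  exact hmin s hs (by omega) (hj.res_eq_zero_of_long (by rwa [Nat.add_sub_cancel_left])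
    (dispMul_ne_zero (h0 q hq)) hb hb0 hs (by omega) hsl)

end Periodic

section Aperiodic

lemma eq_of_res_eq_zero {γ : ℝ} {n z z' : ℕ} (hγ : ∀ p, 1 ≤ p → 2 * p ≤ n → res γ p ≠ 0)
    (h1 : 1 ≤ z) (hn : z ≤ n) (h0 : res γ z = 0) (h1' : 1 ≤ z') (hn' : z' ≤ n)
    (h0' : res γ z' = 0) : z = z' := by
  wlog hlt : z < z' generalizing z z'
  · by_contra hne
    exact hne (this h1' hn' h0' h1 hn h0 (by omega)).symm
  exfalso
  by_cases h : 2 * z ≤ n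
  · exact hγ z h1 h h0
  · exact hγ (z' - z) (by omega) (by omega) (res_sub_eq_zero hlt.le h0' h0)

lemma eq_of_abs_res_eq_half {γ : ℝ} {n p p' : ℕ} (hn : 8 ≤ n)
    (hγ : ∀ z, 1 ≤ z → z + 4 ≤ n → res γ z ≠ 0) (h1 : 1 ≤ p) (hpn : p < n)
    (hp : |res γ p| = 1 / 2) (h1' : 1 ≤ p') (hpn' : p' < n) (hp' : |res γ p'| = 1 / 2) :
    p = p' := by
  wlog hlt : p < p' generalizing p p'
  · by_contra hne
    exact hne (this h1' hpn' hp' h1 hpn hp (by omega)).symm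
  exfalso
  by_cases h : p' - p + 4 ≤ n
  · exact hγ (p' - p) (by omega) h (res_sub_eq_zero_of_half hlt.le hp' hp)
  · exact hγ (2 * p) (by omega) (by omega) (res_two_mul_eq_zero hp)

lemma two_mul_eq_of_abs_res_eq_half {γ : ℝ} {n p z : ℕ} (hn : 8 ≤ n)
    (hγ : ∀ p, 1 ≤ p → 2 * p ≤ n → res γ p ≠ 0)
    (hγ' : ∀ z, 1 ≤ z → z + 4 ≤ n → res γ z ≠ 0) (h1 : 1 ≤ p) (hpn : p < n)
    (hp : |res γ p| = 1 / 2) (hz : 1 ≤ z) (hzn : z < n) (hz0 : res γ z = 0) : 2 * p = z := by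
  have h2 := res_two_mul_eq_zero hp
  have hz4 : n < z + 4 := by
    by_contra h
    exact hγ' z hz (by omega) hz0
  by_cases h2n : 2 * p ≤ n
  · exact eq_of_res_eq_zero hγ (by omega) h2n h2 hz hzn.le hz0
  exfalso
  rcases lt_trichotomy p z with h | h | h
  · have := eq_of_res_eq_zero hγ (by omega) (by omega)
      (res_sub_eq_zero (by omega : z ≤ 2 * p) h2 hz0) hz hzn.le hz0
    omega
  · rw [h, hz0, abs_zero] at hp
    norm_num at hp
  · exact hγ' (2 * (p - z)) (by omega) (by omega)
      (res_two_mul_eq_zero (abs_res_sub_eq_half h.le hp hz0))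

variable {α β : ℝ} {n : ℕ} {F : Finset ℕ}

lemma card_image_len2_le_eight (hF : ∀ q ∈ F, Surviving α β n q) {j k : ℕ}
    (h : Undefeated α β n j k) (hα : dispMul α j k ≠ 0) (hβ : dispMul β j k ≠ 0)
    (hlt : ∀ p ∈ F, len2 α β p < len2 α β (k - j)) (hpos : ∀ p ∈ F, 0 < len2 α β p)
    (hFα : ∀ p ∈ F, |res α p| < 1 / 2) (hFβ : ∀ p ∈ F, |res β p| < 1 / 2) :
    (F.image (len2 α β)).card ≤ 8 := by
  classical
  refine (card_image_le_of_color _ (fun p => octant (res α p) (res β p)) _ ?_).trans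
    ((Finset.card_le_univ _).trans (by simp))
  exact fun p hp p' hp' hl => h.octant_ne (hF p hp) (hF p' hp') (hpos p hp) hl (hlt p' hp')
    (hFα p hp) (hFβ p hp) (hFα p' hp') (hFβ p' hp') (Or.inl hα) (Or.inl hβ)

lemma len2_pos_of_ne_zero {q : ℕ} (h : res α q ≠ 0 ∨ res β q ≠ 0) : 0 < len2 α β q := by
  rcases h with h | h
  · exact (abs_pos.2 h).trans_le (abs_res_left_le_len2 _ _ _)
  · exact (abs_pos.2 h).trans_le (abs_res_right_le_len2 _ _ _)

lemma len2_le_half_of_mul_eq_zero {q : ℕ} (h : res α q * res β q = 0) :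
    len2 α β q ≤ 1 / 2 := by
  have ha := sq_le_sq' (abs_le.1 (abs_res_le α q)).1 (abs_le.1 (abs_res_le α q)).2
  have hb := sq_le_sq' (abs_le.1 (abs_res_le β q)).1 (abs_le.1 (abs_res_le β q)).2
  refine le_of_sq_le_sq ?_ (by norm_num)
  rw [len2_sq]
  rcases mul_eq_zero.1 h with h | h <;> rw [h] at * <;> linarith

lemma card_image_len2_le_of_short (hF : ∀ q ∈ F, Surviving α β n q)
    (hα : ∀ p, 1 ≤ p → 2 * p ≤ n → res α p ≠ 0) (hβ : ∀ p, 1 ≤ p → 2 * p ≤ n → res β p ≠ 0)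
    (hs : ∀ q ∈ F, len2 α β q ≤ 1 / 2) : (F.image (len2 α β)).card ≤ 11 := by
  classical
  refine (card_image_filter_add _ _ fun p => res α p = 0).trans ?_
  refine Nat.add_le_add (b := 1) (d := 10) (card_image_le_one _ _ fun p hp q hq => ?_) ?_
  · rw [Finset.mem_filter] at hp hq
    rw [eq_of_res_eq_zero hα (hF p hp.1).one_le (hF p hp.1).lt.le hp.2
      (hF q hq.1).one_le (hF q hq.1).lt.le hq.2]
  refine (card_image_filter_add _ _ fun p => res β p = 0).trans ?_
  refine Nat.add_le_add (b := 1) (d := 9) (card_image_le_one _ _ fun p hp q hq => ?_) ?_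
  · simp only [Finset.mem_filter] at hp hq
    rw [eq_of_res_eq_zero hβ (hF p hp.1.1).one_le (hF p hp.1.1).lt.le hp.2
      (hF q hq.1.1).one_le (hF q hq.1.1).lt.le hq.2]
  refine card_image_le_succ _ _ 8 fun q hq _ => ?_
  simp only [Finset.mem_filter] at hq
  obtain ⟨j, hj⟩ := hF q hq.1.1
  refine card_image_len2_le_eight (n := n) ?_ hj (dispMul_ne_zero hq.1.2) (dispMul_ne_zero hq.2)
    ?_ ?_ ?_ ?_ <;> intro p hp <;> simp only [Finset.mem_filter] at hp
  · exact hF p hp.1.1.1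
  · rw [Nat.add_sub_cancel_left]
    exact hp.2
  · exact len2_pos_of_ne_zero (Or.inl hp.1.1.2)
  · exact (abs_res_left_le_len2 _ _ _).trans_lt (hp.2.trans_le (hs q hq.1.1))
  · exact (abs_res_right_le_len2 _ _ _).trans_lt (hp.2.trans_le (hs q hq.1.1))

lemma card_image_len2_le_two (hF : ∀ q ∈ F, 1 ≤ q ∧ q < n) (hn : 8 ≤ n)
    (hα : ∀ p, 1 ≤ p → 2 * p ≤ n → res α p ≠ 0) (hβ : ∀ p, 1 ≤ p → 2 * p ≤ n → res β p ≠ 0)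
    (hα' : ∀ z, 1 ≤ z → z + 4 ≤ n → res α z ≠ 0) (hβ' : ∀ z, 1 ≤ z → z + 4 ≤ n → res β z ≠ 0)
    (hd : ∀ q ∈ F, (|res α q| = 1 / 2 ∨ |res β q| = 1 / 2) ∨ (res α q = 0 ∧ res β q = 0)) :
    (F.image (len2 α β)).card ≤ 2 := by
  classical
  by_cases hz : ∃ z ∈ F, res α z = 0 ∧ res β z = 0
  · obtain ⟨z, hzF, hzα, hzβ⟩ := hz
    obtain ⟨hz1, hzn⟩ := hF z hzF
    refine Finset.card_image_le.trans ((Finset.card_le_card (t := {z, z / 2}) ?_).trans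
      Finset.card_le_two)
    intro p hp
    obtain ⟨hp1, hpn⟩ := hF p hp
    rw [Finset.mem_insert, Finset.mem_singleton]
    rcases hd p hp with (h | h) | h
    · have := two_mul_eq_of_abs_res_eq_half hn hα hα' hp1 hpn h hz1 hzn hzα
      omega
    · have := two_mul_eq_of_abs_res_eq_half hn hβ hβ' hp1 hpn h hz1 hzn hzβ
      omega
    · exact Or.inl (eq_of_res_eq_zero hα hp1 hpn.le h.1 hz1 hzn.le hzα)
  · refine (card_image_filter_add _ _ fun p => |res α p| = 1 / 2).trans ?_
    refine Nat.add_le_add (b := 1) (d := 1) (card_image_le_one _ _ fun p hp q hq => ?_)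
      (card_image_le_one _ _ fun p hp q hq => ?_)
    · rw [Finset.mem_filter] at hp hq
      rw [eq_of_abs_res_eq_half hn hα' (hF p hp.1).1 (hF p hp.1).2 hp.2
        (hF q hq.1).1 (hF q hq.1).2 hq.2]
    · have key : ∀ q ∈ F.filter fun p => ¬|res α p| = 1 / 2, q ∈ F ∧ |res β q| = 1 / 2 := by
        intro q hq
        rw [Finset.mem_filter] at hq
        exact ⟨hq.1, ((hd q hq.1).resolve_right fun h => hz ⟨q, hq.1, h⟩).resolve_left hq.2⟩
      obtain ⟨hp, hp2⟩ := key p hp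
      obtain ⟨hq, hq2⟩ := key q hq
      rw [eq_of_abs_res_eq_half hn hβ' (hF p hp).1 (hF p hp).2 hp2 (hF q hq).1 (hF q hq).2 hq2]

lemma card_image_len2_le_of_long (hF : ∀ q ∈ F, Surviving α β n q) (hn : 8 ≤ n)
    (hα : ∀ p, 1 ≤ p → 2 * p ≤ n → res α p ≠ 0) (hβ : ∀ p, 1 ≤ p → 2 * p ≤ n → res β p ≠ 0)
    (hl : ∃ q ∈ F, 1 / 2 < len2 α β q) : (F.image (len2 α β)).card ≤ 11 := by
  classical
  obtain ⟨m, hmF, hm⟩ := hl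
  have hmα : res α m ≠ 0 := fun h =>
    (len2_le_half_of_mul_eq_zero (by rw [h, zero_mul])).not_gt hm
  have hmβ : res β m ≠ 0 := fun h =>
    (len2_le_half_of_mul_eq_zero (by rw [h, mul_zero])).not_gt hm
  obtain ⟨i, hi⟩ := hF m hmF
  obtain ⟨s, hs, hs4, hsl⟩ := exists_multiple_short α β
  have hα' : ∀ z, 1 ≤ z → z + 4 ≤ n → res α z ≠ 0 := fun z hz hzn h0 =>
    hα s hs (by omega) (hi.swap.res_eq_zero_of_long
      (by rw [Nat.add_sub_cancel_left, len2_comm]; exact hm.le)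
      (dispMul_ne_zero hmα) hz h0 hs (by omega) (by rwa [len2_comm]))
  have hβ' : ∀ z, 1 ≤ z → z + 4 ≤ n → res β z ≠ 0 := fun z hz hzn h0 =>
    hβ s hs (by omega) (hi.res_eq_zero_of_long
      (by rw [Nat.add_sub_cancel_left]; exact hm.le)
      (dispMul_ne_zero hmβ) hz h0 hs (by omega) hsl)
  refine (card_image_filter_add _ _ fun q =>
    (|res α q| = 1 / 2 ∨ |res β q| = 1 / 2) ∨ (res α q = 0 ∧ res β q = 0)).trans ?_
  refine Nat.add_le_add (b := 2) (d := 9)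
    (card_image_len2_le_two (n := n) ?_ hn hα hβ hα' hβ' ?_) ?_
  · intro q hq
    have := hF q (Finset.mem_filter.1 hq).1
    exact ⟨this.one_le, this.lt⟩
  · exact fun q hq => (Finset.mem_filter.1 hq).2
  refine card_image_le_succ _ _ 8 fun q hq _ => ?_
  obtain ⟨q', hqF', hqα', hqβ', hqq'⟩ :
      ∃ q' ∈ F, res α q' ≠ 0 ∧ res β q' ≠ 0 ∧ len2 α β q ≤ len2 α β q' := by
    by_cases h0 : res α q * res β q = 0
    · exact ⟨m, hmF, hmα, hmβ, (len2_le_half_of_mul_eq_zero h0).trans hm.le⟩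
    · exact ⟨q, (Finset.mem_filter.1 hq).1, left_ne_zero_of_mul h0, right_ne_zero_of_mul h0, le_rfl⟩
  obtain ⟨j, hj⟩ := hF q' hqF'
  refine card_image_len2_le_eight (n := n) ?_ hj (dispMul_ne_zero hqα') (dispMul_ne_zero hqβ')
    ?_ ?_ ?_ ?_ <;> intro p hp <;> simp only [Finset.mem_filter, not_or, not_and_or] at hp
  · exact hF p hp.1.1
  · rw [Nat.add_sub_cancel_left]
    exact hp.2.trans_le hqq'
  · exact len2_pos_of_ne_zero hp.1.2.2
  · exact (abs_res_le _ _).lt_of_ne hp.1.2.1.1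
  · exact (abs_res_le _ _).lt_of_ne hp.1.2.1.2

end Aperiodic

lemma card_image_len2_le {α β : ℝ} {n : ℕ} {F : Finset ℕ} (hF : ∀ q ∈ F, Surviving α β n q) :
    (F.image (len2 α β)).card ≤ 11 := by
  classical
  rcases Nat.lt_or_ge n 13 with hn | hn
  · refine Finset.card_image_le.trans ((Finset.card_le_card (t := Finset.Ioo 0 n) ?_).trans ?_)
    · exact fun q hq => Finset.mem_Ioo.2 ⟨(hF q hq).one_le, (hF q hq).lt⟩
    · rw [Nat.card_Ioo]
      omega
  by_cases hβ : ∃ z, 1 ≤ z ∧ 2 * z ≤ n ∧ res β z = 0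
  · exact card_image_len2_le_of_exists_period hF hn hβ
  by_cases hα : ∃ z, 1 ≤ z ∧ 2 * z ≤ n ∧ res α z = 0
  · rw [show len2 α β = len2 β α from funext (len2_comm α β)]
    exact card_image_len2_le_of_exists_period (fun q hq => (hF q hq).swap) hn hα
  push Not at hα hβ
  by_cases hl : ∃ q ∈ F, 1 / 2 < len2 α β q
  · exact card_image_len2_le_of_long hF (by omega) hα hβ hl
  · push Not at hl
    exact card_image_len2_le_of_short hF hα hβ hl

/-- The paper's main theorem: the set of Euclidean distances
`d(j,k) = √(‖(k−j)α‖² + ‖(k−j)β‖²)` of pairs `1 ≤ j < k ≤ n` which are not defeated by any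
strictly shorter pair overlapping in one of the two coordinate projections has at most
11 elements. -/
theorem eleven_distances (α β : ℝ) (n : ℕ) (hn : 1 ≤ n) :
    Set.ncard { d : ℝ | ∃ j k : ℕ, 1 ≤ j ∧ j < k ∧ k ≤ n ∧
        d = len2 α β (k - j) ∧
        ∀ p q : ℕ, 1 ≤ p → p < q → q ≤ n →
          len2 α β (q - p) < len2 α β (k - j) →
            geodesic (Int.fract ((p : ℝ) * α)) (Int.fract ((q : ℝ) * α)) ∩
                geodesic (Int.fract ((j : ℝ) * α)) (Int.fract ((k : ℝ) * α)) = ∅ ∧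
              geodesic (Int.fract ((p : ℝ) * β)) (Int.fract ((q : ℝ) * β)) ∩
                geodesic (Int.fract ((j : ℝ) * β)) (Int.fract ((k : ℝ) * β)) = ∅ } ≤ 11 := by
  classical
  refine (Set.ncard_le_ncard (t := (((Finset.range n).filter (Surviving α β n)).image
    (len2 α β) : Finset ℝ)) ?_ (Finset.finite_toSet _)).trans ?_
  · rintro d ⟨j, k, hj, hjk, hk, rfl, hd⟩
    obtain ⟨q, rfl⟩ : ∃ q, k = j + q := ⟨k - j, by omega⟩
    have hS : Surviving α β n q := by
      refine ⟨j, hj, hjk, hk, fun p hp hl i hi hin => ?_, fun p hp hl i hi hin => ?_⟩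
      · exact (hd i (i + p) hi (by omega) hin (by rwa [Nat.add_sub_cancel_left])).1
      · exact (hd i (i + p) hi (by omega) hin (by rwa [Nat.add_sub_cancel_left])).2
    rw [Nat.add_sub_cancel_left]
    exact Finset.mem_coe.2 (Finset.mem_image_of_mem _
      (Finset.mem_filter.2 ⟨Finset.mem_range.2 hS.lt, hS⟩))
  · rw [Set.ncard_coe_finset]
    exact card_image_len2_le fun q hq => (Finset.mem_filter.1 hq).2
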